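/- arXiv:2506.03441 — 3 statements merged into one kernel-verified Lean document; each statement's English description precedes it below -/
import Mathlib

section
/- For the unweighted star graph S_m with m edges and any 1 ≤ k ≤ (m+1)/2, the minimum eigenvalue of the adjacency matrix of the k-th token graph F_k(S_m) is at least -√(k(m+1-k)). -/
open Matrix Finset

noncomputable section

/-- Edge weight between vertices `A`, `B` of a token graph: nonzero exactly when the
symmetric difference of `A` and `B` is an edge `{a, b}` of `G` with `a ∈ A`, `b ∈ B`,
in which case it is `w a b`. -/
def tokenW {n : ℕ} (w : Fin n → Fin n → ℝ) (A B : Finset (Fin n)) : ℝ :=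
  ∑ a ∈ A \ B, ∑ b ∈ B \ A, if A \ {a} = B \ {b} then w a b else 0

/-- Vertices of the `k`-th token graph on `[n]`: the `k`-element subsets. -/
abbrev TokenVert (n k : ℕ) := {s : Finset (Fin n) // s.card = k}

/-- Weighted adjacency matrix of the `k`-th token graph `F_k(G)`. -/
def tokenA {n : ℕ} (w : Fin n → Fin n → ℝ) (k : ℕ) :
    Matrix (TokenVert n k) (TokenVert n k) ℝ :=
  Matrix.of fun A B => tokenW w A.1 B.1

/-- Weighted degree matrix of `F_k(G)`. -/
def tokenD {n : ℕ} (w : Fin n → Fin n → ℝ) (k : ℕ) :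
    Matrix (TokenVert n k) (TokenVert n k) ℝ :=
  Matrix.diagonal fun A => ∑ B : TokenVert n k, tokenW w A.1 B.1

/-- Weighted Laplacian of `F_k(G)`. -/
def tokenL {n : ℕ} (w : Fin n → Fin n → ℝ) (k : ℕ) :
    Matrix (TokenVert n k) (TokenVert n k) ℝ :=
  tokenD w k - tokenA w k

/-- Weighted signless Laplacian of `F_k(G)`. -/
def tokenQ {n : ℕ} (w : Fin n → Fin n → ℝ) (k : ℕ) :
    Matrix (TokenVert n k) (TokenVert n k) ℝ :=
  tokenD w k + tokenA w k

/-- Weight function of the unweighted star graph `S_m` on `Fin (m+1)`: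
vertex `0` (the center) is adjacent to all other vertices. -/
def starW (m : ℕ) : Fin (m + 1) → Fin (m + 1) → ℝ :=
  fun i j => if i ≠ j ∧ (i = 0 ∨ j = 0) then 1 else 0

/-- Perron-type bound: if a nonnegative real matrix has a positive vector `f` with
`M f ≤ r f` entrywise, then every real eigenvalue has absolute value at most `r`. -/
theorem Matrix.abs_le_of_mem_spectrum_of_mulVec_le {ι : Type*} [Fintype ι] [DecidableEq ι]
    {M : Matrix ι ι ℝ} (hM : ∀ i j, 0 ≤ M i j) {f : ι → ℝ} (hf : ∀ i, 0 < f i) {r : ℝ}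
    (hMf : ∀ i, (M *ᵥ f) i ≤ r * f i) {μ : ℝ} (hμ : μ ∈ spectrum ℝ M) : |μ| ≤ r := by
  rw [← Matrix.spectrum_toLin', ← Module.End.hasEigenvalue_iff_mem_spectrum] at hμ
  obtain ⟨v, hv⟩ := hμ.exists_hasEigenvector
  have hMv : M *ᵥ v = μ • v := by simpa using hv.apply_eq_smul
  obtain ⟨j, hj⟩ := Function.ne_iff.mp hv.2
  have : Nonempty ι := ⟨j⟩
  obtain ⟨i, hi⟩ := Finite.exists_max fun i => |v i| / f i
  set c := |v i| / f i
  have hc : 0 < c := lt_of_lt_of_le (div_pos (abs_pos.mpr hj) (hf j)) (hi j)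
  have hvi : |v i| = c * f i := (div_mul_cancel₀ _ (hf i).ne').symm
  have key : |μ| * (c * f i) ≤ r * (c * f i) := calc
    |μ| * (c * f i) = |(M *ᵥ v) i| := by rw [hMv, ← hvi, Pi.smul_apply, smul_eq_mul, abs_mul]
    _ ≤ ∑ j, |M i j * v j| := Finset.abs_sum_le_sum_abs _ _
    _ ≤ ∑ j, c * (M i j * f j) := by
      refine Finset.sum_le_sum fun j _ => ?_
      rw [abs_mul, abs_of_nonneg (hM i j), mul_left_comm]
      exact mul_le_mul_of_nonneg_left ((div_le_iff₀ (hf j)).mp (hi j)) (hM i j)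
    _ = c * (M *ᵥ f) i := by rw [← Finset.mul_sum]; rfl
    _ ≤ c * (r * f i) := mul_le_mul_of_nonneg_left (hMf i) hc.le
    _ = r * (c * f i) := by ring
  exact le_of_mul_le_mul_right key (mul_pos hc (hf i))

/-- Token weights as a sum over all moves of a token from `a ∈ A` to a free vertex `b`. -/
theorem tokenW_eq_sum_moves {n : ℕ} (w : Fin n → Fin n → ℝ) (A B : Finset (Fin n)) :
    tokenW w A B = ∑ a ∈ A, ∑ b ∈ Aᶜ, if B = insert b (A.erase a) then w a b else 0 := by
  have hmove : ∀ a ∈ A, ∀ b ∈ Aᶜ, (B = insert b (A.erase a) ↔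
      a ∉ B ∧ b ∈ B ∧ A \ {a} = B \ {b}) := by
    intro a ha b hb
    rw [mem_compl] at hb
    constructor
    · rintro rfl
      have hab : a ≠ b := fun h => hb (h ▸ ha)
      refine ⟨by simp [hab], by simp, ?_⟩
      ext x
      simp only [mem_sdiff, mem_singleton, mem_insert, mem_erase]
      grind
    · rintro ⟨-, hbB, h⟩
      rw [erase_eq, h, ← erase_eq, insert_erase hbB]
  rw [tokenW, sdiff_eq_filter, sum_filter]
  refine sum_congr rfl fun a ha => ?_
  have hBA : B \ A = Aᶜ.filter (· ∈ B) := by ext; simp [and_comm]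
  rw [hBA, sum_filter]
  by_cases haB : a ∈ B
  · rw [if_neg (not_not.mpr haB)]
    exact (sum_eq_zero fun b hb => if_neg (by simp [hmove a ha b hb, haB])).symm
  · rw [if_pos haB]
    refine sum_congr rfl fun b hb => ?_
    by_cases hbB : b ∈ B <;> simp [hmove a ha b hb, haB, hbB]

theorem tokenA_mulVec_apply {n k : ℕ} (w : Fin n → Fin n → ℝ) (g : Finset (Fin n) → ℝ)
    (A : TokenVert n k) :
    (tokenA w k *ᵥ fun B => g B.1) A =
      ∑ a ∈ A.1, ∑ b ∈ A.1ᶜ, w a b * g (insert b (A.1.erase a)) := by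
  simp only [mulVec, dotProduct, tokenA, of_apply, tokenW_eq_sum_moves, sum_mul]
  rw [sum_comm]
  refine sum_congr rfl fun a ha => ?_
  rw [sum_comm]
  refine sum_congr rfl fun b hb => ?_
  have hcard : (insert b (A.1.erase a)).card = k := by
    have hbA : b ∉ A.1.erase a := fun h => mem_compl.mp hb (mem_of_mem_erase h)
    rw [card_insert_of_notMem hbA, card_erase_add_one ha, A.2]
  rw [Fintype.sum_eq_single ⟨_, hcard⟩]
  · simp
  · intro B hB
    rw [if_neg fun h => hB (Subtype.ext h), zero_mul]

theorem starW_nonneg (m : ℕ) (i j : Fin (m + 1)) : 0 ≤ starW m i j := by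
  unfold starW
  split_ifs <;> norm_num

theorem tokenA_nonneg {n : ℕ} {w : Fin n → Fin n → ℝ} (hw : ∀ i j, 0 ≤ w i j) (k : ℕ)
    (A B : TokenVert n k) : 0 ≤ tokenA w k A B := by
  refine sum_nonneg fun a _ => sum_nonneg fun b _ => ?_
  split_ifs
  exacts [hw a b, le_rfl]

/-- The token graph of a star is biregular, so any function depending only on whether the
center is occupied is mapped to another such function. -/
theorem tokenA_starW_mulVec_apply {m k : ℕ} (x y : ℝ) (A : TokenVert (m + 1) k) :
    (tokenA (starW m) k *ᵥ fun B => if 0 ∈ B.1 then x else y) A =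
      if 0 ∈ A.1 then ((m : ℝ) + 1 - k) * y else k * x := by
  rw [tokenA_mulVec_apply (starW m) (fun B => if 0 ∈ B then x else y)]
  obtain ⟨A, hA⟩ := A
  dsimp only
  split_ifs with h0
  · have hcompl : ((Aᶜ.card : ℕ) : ℝ) = (m : ℝ) + 1 - k := by
      have := card_add_card_compl A
      rw [hA, Fintype.card_fin] at this
      rw [eq_sub_iff_add_eq']
      exact_mod_cast this
    rw [sum_eq_single_of_mem 0 h0, ← hcompl, ← nsmul_eq_mul, ← sum_const]
    · refine sum_congr rfl fun b hb => ?_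
      have hb0 : 0 ≠ b := fun h => mem_compl.mp hb (h ▸ h0)
      simp [starW, hb0]
    · intro a _ ha
      refine sum_eq_zero fun b hb => ?_
      have hb0 : b ≠ 0 := fun h => mem_compl.mp hb (h ▸ h0)
      simp [starW, ha, hb0]
  · subst hA
    rw [← nsmul_eq_mul, ← sum_const]
    refine sum_congr rfl fun a ha => ?_
    have ha0 : a ≠ 0 := fun h => h0 (h ▸ ha)
    rw [sum_eq_single_of_mem 0 (mem_compl.mpr h0)]
    · simp [starW, ha0]
    · intro b _ hb
      simp [starW, ha0, hb]

/-- For the star `S_m` and `1 ≤ k ≤ (m+1)/2`, every adjacency eigenvalue of the token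
graph `F_k(S_m)` is at least `-√(k (m + 1 - k))`, i.e. the minimum eigenvalue is at
least `-√(k (m + 1 - k))`. -/
theorem star_tokenA_minEig (m k : ℕ) (hm : 1 ≤ m) (hk : 1 ≤ k) (hkm : 2 * k ≤ m + 1) :
    ∀ μ ∈ spectrum ℝ (tokenA (starW m) k),
      -Real.sqrt ((k : ℝ) * ((m : ℝ) + 1 - (k : ℝ))) ≤ μ := by
  intro μ hμ
  have hk0 : (0 : ℝ) < k := by exact_mod_cast hk
  have hd0 : (0 : ℝ) < (m : ℝ) + 1 - k := by
    have : (2 : ℝ) * k ≤ m + 1 := by exact_mod_cast hkm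
    linarith
  set d : ℝ := (m : ℝ) + 1 - k
  refine (abs_le.mp (Matrix.abs_le_of_mem_spectrum_of_mulVec_le
    (tokenA_nonneg (starW_nonneg m) k)
    (f := fun B => if 0 ∈ B.1 then √d else √k) (fun B => ?_) (fun A => ?_) hμ)).1
  · split_ifs
    exacts [Real.sqrt_pos.mpr hd0, Real.sqrt_pos.mpr hk0]
  · rw [tokenA_starW_mulVec_apply, Real.sqrt_mul hk0.le]
    have hk2 := Real.mul_self_sqrt hk0.le
    have hd2 := Real.mul_self_sqrt hd0.le
    split_ifs
    · exact le_of_eq (by linear_combination -√k * hd2)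
    · exact le_of_eq (by linear_combination -√d * hk2)
end
end

section
/- For a connected weighted graph G, the EPR Hamiltonian H^EPR(G) admits an eigenstate for its maximum eigenvalue whose coefficients in the tensor-product basis of Pauli-Y eigenstates are all real and nonnegative. -/
open Matrix Finset

noncomputable section

/-- Computational basis states of `n` qubits. -/
abbrev QState (n : ℕ) := Fin n → Fin 2

/-- Pauli `X` matrix. -/
def pauliX : Matrix (Fin 2) (Fin 2) ℂ := !![0, 1; 1, 0]

/-- Pauli `Y` matrix. -/
def pauliY : Matrix (Fin 2) (Fin 2) ℂ := !![0, -Complex.I; Complex.I, 0]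

/-- Pauli `Z` matrix. -/
def pauliZ : Matrix (Fin 2) (Fin 2) ℂ := !![1, 0; 0, -1]

/-- The operator acting as `P` on qubit `i`, `Q` on qubit `j`, and the identity on all
other qubits of an `n`-qubit system. -/
def twoSite (n : ℕ) (i j : Fin n) (P Q : Matrix (Fin 2) (Fin 2) ℂ) :
    Matrix (QState n) (QState n) ℂ :=
  Matrix.of fun x y =>
    P (x i) (y i) * Q (x j) (y j) *
      ∏ l ∈ Finset.univ \ {i, j}, (if x l = y l then (1 : ℂ) else 0)

/-- Quantum MaxCut term on the pair `(i,j)`: `(1/2)(I - XᵢXⱼ - YᵢYⱼ - ZᵢZⱼ)`. -/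
def hQMC (n : ℕ) (i j : Fin n) : Matrix (QState n) (QState n) ℂ :=
  (1 / 2 : ℂ) • ((1 : Matrix (QState n) (QState n) ℂ)
    - twoSite n i j pauliX pauliX - twoSite n i j pauliY pauliY
    - twoSite n i j pauliZ pauliZ)

/-- XY term on the pair `(i,j)`: `(1/2)(I - XᵢXⱼ - YᵢYⱼ)`. -/
def hXY (n : ℕ) (i j : Fin n) : Matrix (QState n) (QState n) ℂ :=
  (1 / 2 : ℂ) • ((1 : Matrix (QState n) (QState n) ℂ)
    - twoSite n i j pauliX pauliX - twoSite n i j pauliY pauliY)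

/-- EPR term on the pair `(i,j)`: `(1/2)(I + XᵢXⱼ - YᵢYⱼ + ZᵢZⱼ)`. -/
def hEPR (n : ℕ) (i j : Fin n) : Matrix (QState n) (QState n) ℂ :=
  (1 / 2 : ℂ) • ((1 : Matrix (QState n) (QState n) ℂ)
    + twoSite n i j pauliX pauliX - twoSite n i j pauliY pauliY
    + twoSite n i j pauliZ pauliZ)

/-- Quantum MaxCut Hamiltonian of a weighted graph given by a symmetric weight
function `w` (each edge is counted twice in the double sum, whence the factor `1/2`). -/
def HQMC (n : ℕ) (w : Fin n → Fin n → ℝ) : Matrix (QState n) (QState n) ℂ :=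
  (1 / 2 : ℂ) • ∑ i, ∑ j, (w i j : ℂ) • hQMC n i j

/-- XY Hamiltonian of a weighted graph. -/
def HXY (n : ℕ) (w : Fin n → Fin n → ℝ) : Matrix (QState n) (QState n) ℂ :=
  (1 / 2 : ℂ) • ∑ i, ∑ j, (w i j : ℂ) • hXY n i j

/-- EPR Hamiltonian of a weighted graph. -/
def HEPR (n : ℕ) (w : Fin n → Fin n → ℝ) : Matrix (QState n) (QState n) ℂ :=
  (1 / 2 : ℂ) • ∑ i, ∑ j, (w i j : ℂ) • hEPR n i j

/-- The largest (real) eigenvalue of a Hamiltonian: the supremum of the real numbers in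
its complex spectrum. -/
def maxEigH {n : ℕ} (H : Matrix (QState n) (QState n) ℂ) : ℝ :=
  sSup {r : ℝ | (r : ℂ) ∈ spectrum ℂ H}

/-- The single-qubit Pauli-`Y` eigenstates: `yket 0 = |+i⟩`, `yket 1 = |-i⟩`. -/
def yket (s : Fin 2) : Fin 2 → ℂ := fun t =>
  ((1 / Real.sqrt 2 : ℝ) : ℂ) *
    (if t = 0 then 1 else if s = 0 then Complex.I else -Complex.I)

/-- Tensor-product Pauli-`Y` basis state labelled by `z : {±i}ⁿ`. -/
def yBasis {n : ℕ} (z : QState n) : QState n → ℂ := fun x => ∏ l, yket (z l) (x l)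

open scoped ComplexOrder

section PerronFrobenius

variable {ι : Type*} [Fintype ι] [DecidableEq ι]

/-- Weak Perron–Frobenius for Hermitian matrices: if all entries are nonnegative, then the
entrywise modulus of an eigenvector for an eigenvalue bounding the spectrum from above is again an
eigenvector. -/
theorem Matrix.IsHermitian.mulVec_norm_eq_smul {M : Matrix ι ι ℂ} (hM : M.IsHermitian)
    (hM0 : ∀ x z, 0 ≤ M x z) {μ : ℝ} (hμ : ∀ r ∈ spectrum ℂ M, r ≤ (μ : ℂ))
    {v : ι → ℂ} (hv : M *ᵥ v = (μ : ℂ) • v) :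
    M *ᵥ (fun z => (‖v z‖ : ℂ)) = (μ : ℂ) • fun z => (‖v z‖ : ℂ) := by
  set c : ι → ℂ := fun z => (‖v z‖ : ℂ) with hc
  set A : Matrix ι ι ℂ := algebraMap ℂ (Matrix ι ι ℂ) μ - M with hA
  have hAv (u : ι → ℂ) : A *ᵥ u = (μ : ℂ) • u - M *ᵥ u := by
    rw [hA, Matrix.sub_mulVec, Algebra.algebraMap_eq_smul_one, Matrix.smul_mulVec,
      Matrix.one_mulVec]
  have hpsd : A.PosSemidef := by
    refine Matrix.posSemidef_iff_isHermitian_and_spectrum_nonneg.mpr ⟨?_, ?_⟩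
    · refine Matrix.IsHermitian.sub ?_ hM
      rw [Algebra.algebraMap_eq_smul_one, Matrix.IsHermitian, Matrix.conjTranspose_smul,
        Matrix.conjTranspose_one, Complex.star_def, Complex.conj_ofReal]
    · rw [hA, ← spectrum.singleton_sub_eq]
      rintro _ ⟨_, rfl, r, hr, rfl⟩
      exact sub_nonneg.mpr (hμ r hr)
  have hMc : star c ⬝ᵥ M *ᵥ c = ((∑ x, ∑ z, ‖v x‖ * (‖M x z‖ * ‖v z‖) : ℝ) : ℂ) := by
    simp only [dotProduct, Matrix.mulVec, Finset.mul_sum, Complex.ofReal_sum, Complex.ofReal_mul]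
    refine Finset.sum_congr rfl fun x _ => Finset.sum_congr rfl fun z _ => ?_
    rw [← Complex.eq_coe_norm_of_nonneg (hM0 x z)]
    simp [hc]
  have hcc : star c ⬝ᵥ c = star v ⬝ᵥ v := by
    simp only [dotProduct, Pi.star_apply, hc, Complex.star_def, Complex.conj_ofReal,
      Complex.conj_mul', sq]
  have hle : star c ⬝ᵥ A *ᵥ c ≤ 0 := by
    have hvv : star v ⬝ᵥ v = ((∑ x, ‖v x‖ ^ 2 : ℝ) : ℂ) := by
      simp [dotProduct, Complex.conj_mul']
    have hquad : (((μ * ∑ x, ‖v x‖ ^ 2 : ℝ)) : ℂ) = star v ⬝ᵥ M *ᵥ v := by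
      rw [hv, dotProduct_smul, hvv, smul_eq_mul, Complex.ofReal_mul]
    have key : μ * ∑ x, ‖v x‖ ^ 2 ≤ ∑ x, ∑ z, ‖v x‖ * (‖M x z‖ * ‖v z‖) := by
      refine (Real.le_norm_self _).trans ?_
      rw [← Complex.norm_real, hquad]
      simp only [dotProduct, Matrix.mulVec, Finset.mul_sum]
      refine (norm_sum_le _ _).trans (Finset.sum_le_sum fun x _ => ?_)
      refine (norm_sum_le _ _).trans (Finset.sum_le_sum fun z _ => ?_)
      simp
    rw [hAv, dotProduct_sub, dotProduct_smul, hcc, hvv, hMc, smul_eq_mul, ← Complex.ofReal_mul,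
      sub_nonpos]
    exact_mod_cast key
  have h0 := (hpsd.dotProduct_mulVec_zero_iff c).mp
    (le_antisymm hle (hpsd.dotProduct_mulVec_nonneg c))
  rw [hAv] at h0
  exact (sub_eq_zero.mp h0).symm

/-- A Hermitian matrix with nonnegative entries has a nonnegative eigenvector for its largest
eigenvalue. -/
theorem Matrix.IsHermitian.exists_nonneg_eigenvector_sSup [Nonempty ι] {M : Matrix ι ι ℂ}
    (hM : M.IsHermitian) (hM0 : ∀ x z, 0 ≤ M x z) :
    ∃ c : ι → ℝ, (∀ z, 0 ≤ c z) ∧ c ≠ 0 ∧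
      M *ᵥ (fun z => (c z : ℂ)) =
        ((sSup {r : ℝ | (r : ℂ) ∈ spectrum ℂ M} : ℝ) : ℂ) • fun z => (c z : ℂ) := by
  have hset : {r : ℝ | (r : ℂ) ∈ spectrum ℂ M} = Set.range hM.eigenvalues := by
    ext r
    simp [hM.spectrum_eq_image_range]
  obtain ⟨i, hi⟩ := (Set.range_nonempty hM.eigenvalues).csSup_mem (Set.finite_range _)
  rw [hset, ← hi]
  refine ⟨fun z => ‖hM.eigenvectorBasis i z‖, fun z => norm_nonneg _, fun h => ?_,
    hM.mulVec_norm_eq_smul hM0 ?_ ?_⟩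
  · refine hM.eigenvectorBasis.orthonormal.ne_zero i ?_
    ext z
    simpa using congrFun h z
  · rw [hM.spectrum_eq_image_range, hi]
    rintro _ ⟨r, hr, rfl⟩
    exact Complex.real_le_real.mpr (le_csSup (Set.finite_range _).bddAbove hr)
  · exact hM.mulVec_eigenvectorBasis i

end PerronFrobenius

section TensorPower

variable {n : ℕ}

/-- The operator `⨂ₗ f l` on `n` qubits. -/
def tensorMatrix (f : Fin n → Matrix (Fin 2) (Fin 2) ℂ) : Matrix (QState n) (QState n) ℂ :=
  Matrix.of fun x y => ∏ l, f l (x l) (y l)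

theorem tensorMatrix_mul (f g : Fin n → Matrix (Fin 2) (Fin 2) ℂ) :
    tensorMatrix f * tensorMatrix g = tensorMatrix fun l => f l * g l := by
  ext x y
  simp only [tensorMatrix, Matrix.mul_apply, Matrix.of_apply, ← Finset.prod_mul_distrib,
    Finset.prod_univ_sum, Fintype.piFinset_univ]

theorem tensorMatrix_conjTranspose (f : Fin n → Matrix (Fin 2) (Fin 2) ℂ) :
    (tensorMatrix f)ᴴ = tensorMatrix fun l => (f l)ᴴ := by
  ext x y
  simp [tensorMatrix, Matrix.conjTranspose_apply]

theorem tensorMatrix_one : tensorMatrix (fun _ : Fin n => 1) = 1 := by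
  ext x y
  simp [tensorMatrix, Matrix.one_apply, Finset.prod_ite_zero, funext_iff]

theorem twoSite_eq_tensorMatrix {i j : Fin n} (hij : i ≠ j) (P Q : Matrix (Fin 2) (Fin 2) ℂ) :
    twoSite n i j P Q = tensorMatrix fun l => if l = i then P else if l = j then Q else 1 := by
  ext x y
  rw [twoSite, tensorMatrix, Matrix.of_apply, Matrix.of_apply,
    ← Finset.prod_sdiff (Finset.subset_univ {i, j}), mul_comm, Finset.prod_pair hij]
  congr 1
  · refine Finset.prod_congr rfl fun l hl => ?_
    simp only [Finset.mem_sdiff, Finset.mem_univ, true_and, Finset.mem_insert,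
      Finset.mem_singleton, not_or] at hl
    simp [hl.1, hl.2, Matrix.one_apply]
  · simp [hij.symm]

theorem twoSite_one_one {i j : Fin n} (hij : i ≠ j) : twoSite n i j 1 1 = 1 := by
  rw [twoSite_eq_tensorMatrix hij, ← tensorMatrix_one]
  simp

theorem isHermitian_twoSite {i j : Fin n} (hij : i ≠ j) {P Q : Matrix (Fin 2) (Fin 2) ℂ}
    (hP : P.IsHermitian) (hQ : Q.IsHermitian) : (twoSite n i j P Q).IsHermitian := by
  rw [Matrix.IsHermitian, twoSite_eq_tensorMatrix hij, tensorMatrix_conjTranspose]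
  congr 1
  ext1 l
  split_ifs
  exacts [hP, hQ, Matrix.conjTranspose_one]

end TensorPower

/-- The unitary whose columns are the single-qubit Pauli-`Y` eigenstates. -/
def yUnitary : Matrix (Fin 2) (Fin 2) ℂ := Matrix.of fun x s => yket s x

/-- The unitary whose columns are the tensor-product Pauli-`Y` basis states. -/
def yBasisMatrix (n : ℕ) : Matrix (QState n) (QState n) ℂ := tensorMatrix fun _ => yUnitary

theorem inv_sqrt_two_mul_self :
    ((1 / Real.sqrt 2 : ℝ) : ℂ) * ((1 / Real.sqrt 2 : ℝ) : ℂ) = 1 / 2 := by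
  rw [← Complex.ofReal_mul, div_mul_div_comm, Real.mul_self_sqrt zero_le_two]
  norm_num

theorem yUnitary_eq :
    yUnitary = ((1 / Real.sqrt 2 : ℝ) : ℂ) • !![1, 1; Complex.I, -Complex.I] := by
  ext i j
  fin_cases i <;> fin_cases j <;> simp [yUnitary, yket]

theorem yUnitary_conjTranspose_eq :
    yUnitaryᴴ = ((1 / Real.sqrt 2 : ℝ) : ℂ) • !![1, -Complex.I; 1, Complex.I] := by
  rw [yUnitary_eq, Matrix.conjTranspose_smul, Complex.star_def, Complex.conj_ofReal]
  congr 1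
  ext i j
  fin_cases i <;> fin_cases j <;> simp

theorem yUnitary_conj (P : Matrix (Fin 2) (Fin 2) ℂ) :
    yUnitaryᴴ * P * yUnitary = (1 / 2 : ℂ) •
      (!![1, -Complex.I; 1, Complex.I] * P * !![1, 1; Complex.I, -Complex.I]) := by
  rw [yUnitary_conjTranspose_eq, yUnitary_eq, Matrix.smul_mul, Matrix.smul_mul, Matrix.mul_smul,
    smul_smul, inv_sqrt_two_mul_self]

theorem yUnitary_conj_pauliX : yUnitaryᴴ * pauliX * yUnitary = pauliY := by
  rw [yUnitary_conj]
  ext i j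
  fin_cases i <;> fin_cases j <;> simp [pauliX, pauliY] <;> ring

theorem yUnitary_conj_pauliY : yUnitaryᴴ * pauliY * yUnitary = pauliZ := by
  rw [yUnitary_conj]
  ext i j
  fin_cases i <;> fin_cases j <;> simp [pauliY, pauliZ] <;> ring

theorem yUnitary_conj_pauliZ : yUnitaryᴴ * pauliZ * yUnitary = pauliX := by
  rw [yUnitary_conj]
  ext i j
  fin_cases i <;> fin_cases j <;> simp [pauliX, pauliZ] <;> ring

theorem yUnitary_conjTranspose_mul_self : yUnitaryᴴ * yUnitary = 1 := by
  rw [← Matrix.mul_one yUnitaryᴴ, yUnitary_conj]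
  ext i j
  fin_cases i <;> fin_cases j <;> simp <;> ring

section EPR

variable {n : ℕ}

theorem yBasisMatrix_conjTranspose_mul_self : (yBasisMatrix n)ᴴ * yBasisMatrix n = 1 := by
  rw [yBasisMatrix, tensorMatrix_conjTranspose, tensorMatrix_mul,
    yUnitary_conjTranspose_mul_self, tensorMatrix_one]

theorem yBasisMatrix_mulVec (c : QState n → ℂ) :
    yBasisMatrix n *ᵥ c = fun x => ∑ z, c z * yBasis z x := by
  ext x
  simp only [Matrix.mulVec, dotProduct, yBasisMatrix, tensorMatrix, yUnitary, yBasis,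
    Matrix.of_apply, mul_comm]

theorem yBasisMatrix_conj_twoSite {i j : Fin n} (hij : i ≠ j) (P Q : Matrix (Fin 2) (Fin 2) ℂ) :
    (yBasisMatrix n)ᴴ * twoSite n i j P Q * yBasisMatrix n =
      twoSite n i j (yUnitaryᴴ * P * yUnitary) (yUnitaryᴴ * Q * yUnitary) := by
  rw [twoSite_eq_tensorMatrix hij, twoSite_eq_tensorMatrix hij, yBasisMatrix,
    tensorMatrix_conjTranspose, tensorMatrix_mul, tensorMatrix_mul]
  congr 1
  ext1 l
  split_ifs
  · rfl
  · rfl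
  · rw [Matrix.mul_one, yUnitary_conjTranspose_mul_self]

theorem yBasisMatrix_conj_hEPR {i j : Fin n} (hij : i ≠ j) :
    (yBasisMatrix n)ᴴ * hEPR n i j * yBasisMatrix n =
      (1 / 2 : ℂ) • (twoSite n i j 1 1 + twoSite n i j pauliY pauliY
        - twoSite n i j pauliZ pauliZ + twoSite n i j pauliX pauliX) := by
  simp only [hEPR, Matrix.mul_smul, Matrix.smul_mul, Matrix.mul_add, Matrix.mul_sub,
    Matrix.add_mul, Matrix.sub_mul, yBasisMatrix_conj_twoSite hij, yUnitary_conj_pauliX,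
    yUnitary_conj_pauliY, yUnitary_conj_pauliZ, Matrix.mul_one,
    yBasisMatrix_conjTranspose_mul_self, twoSite_one_one hij]

theorem yBasisMatrix_conj_hEPR_nonneg {i j : Fin n} (hij : i ≠ j) (x z : QState n) :
    0 ≤ ((yBasisMatrix n)ᴴ * hEPR n i j * yBasisMatrix n) x z := by
  have key : ∀ a b c d : Fin 2, 0 ≤ (1 : Matrix (Fin 2) (Fin 2) ℂ) a b *
      (1 : Matrix (Fin 2) (Fin 2) ℂ) c d + pauliY a b * pauliY c d - pauliZ a b * pauliZ c d
      + pauliX a b * pauliX c d := by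
    intro a b c d
    fin_cases a <;> fin_cases b <;> fin_cases c <;> fin_cases d <;>
      simp [pauliX, pauliY, pauliZ] <;> norm_num
  rw [yBasisMatrix_conj_hEPR hij]
  simp only [Matrix.smul_apply, Matrix.add_apply, Matrix.sub_apply, twoSite, Matrix.of_apply,
    smul_eq_mul, ← add_mul, ← sub_mul]
  have h2 : (0 : ℂ) ≤ 1 / 2 := by simp
  refine mul_nonneg h2 (mul_nonneg (key _ _ _ _) (Finset.prod_nonneg fun l _ => ?_))
  split_ifs
  exacts [zero_le_one, le_rfl]

theorem isHermitian_hEPR {i j : Fin n} (hij : i ≠ j) : (hEPR n i j).IsHermitian := by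
  have hX : pauliX.IsHermitian := by
    ext a b; fin_cases a <;> fin_cases b <;> simp [pauliX]
  have hY : pauliY.IsHermitian := by
    ext a b; fin_cases a <;> fin_cases b <;> simp [pauliY]
  have hZ : pauliZ.IsHermitian := by
    ext a b; fin_cases a <;> fin_cases b <;> simp [pauliZ]
  have h := ((Matrix.isHermitian_one.add (isHermitian_twoSite hij hX hX)).sub
    (isHermitian_twoSite hij hY hY)).add (isHermitian_twoSite hij hZ hZ)
  rw [Matrix.IsHermitian, hEPR, Matrix.conjTranspose_smul, h.eq]
  simp

theorem isHermitian_HEPR {w : Fin n → Fin n → ℝ} (hdiag : ∀ i, w i i = 0) :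
    (HEPR n w).IsHermitian := by
  simp only [Matrix.IsHermitian, HEPR, Matrix.conjTranspose_smul, Matrix.conjTranspose_sum,
    Complex.star_def, Complex.conj_ofReal]
  congr 1
  · simp [Complex.ext_iff]
  · refine Finset.sum_congr rfl fun i _ => Finset.sum_congr rfl fun j _ => ?_
    rcases eq_or_ne i j with rfl | hij
    · simp [hdiag]
    · rw [(isHermitian_hEPR hij).eq]

theorem yBasisMatrix_conj_HEPR_nonneg {w : Fin n → Fin n → ℝ} (hnonneg : ∀ i j, 0 ≤ w i j)
    (hdiag : ∀ i, w i i = 0) (x z : QState n) :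
    0 ≤ ((yBasisMatrix n)ᴴ * HEPR n w * yBasisMatrix n) x z := by
  simp only [HEPR, Matrix.mul_smul, Matrix.smul_mul, Finset.mul_sum, Finset.sum_mul,
    Matrix.smul_apply, Matrix.sum_apply, smul_eq_mul]
  have h2 : (0 : ℂ) ≤ 1 / 2 := by simp
  refine Finset.sum_nonneg fun i _ => Finset.sum_nonneg fun j _ => mul_nonneg h2 ?_
  rcases eq_or_ne i j with rfl | hij
  · simp [hdiag]
  · exact mul_nonneg (by exact_mod_cast hnonneg i j) (yBasisMatrix_conj_hEPR_nonneg hij x z)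

end EPR

/-- For a connected weighted graph with positive edge weights, the EPR Hamiltonian has a
maximum-eigenvalue eigenstate all of whose coefficients in the tensor-product Pauli-`Y`
basis are real and nonnegative. -/
theorem EPR_maxEig_nonneg_in_Ybasis (n : ℕ) (w : Fin n → Fin n → ℝ)
    (hsymm : ∀ i j, w i j = w j i) (hnonneg : ∀ i j, 0 ≤ w i j)
    (hdiag : ∀ i, w i i = 0)
    (hconn : (SimpleGraph.fromRel fun i j : Fin n => w i j ≠ 0).Connected) :
    ∃ c : QState n → ℝ, (∀ z, 0 ≤ c z) ∧ c ≠ 0 ∧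
      (HEPR n w).mulVec (fun x => ∑ z, (c z : ℂ) * yBasis z x)
        = ((maxEigH (HEPR n w) : ℝ) : ℂ) • (fun x => ∑ z, (c z : ℂ) * yBasis z x) := by
  set B := yBasisMatrix n
  set M := Bᴴ * HEPR n w * B with hM
  have hBB : Bᴴ * B = 1 := yBasisMatrix_conjTranspose_mul_self
  have hBB' : B * Bᴴ = 1 := mul_eq_one_comm.mp hBB
  obtain ⟨c, hc0, hc, hMc⟩ := Matrix.IsHermitian.exists_nonneg_eigenvector_sSup
    (Matrix.isHermitian_conjTranspose_mul_mul B (isHermitian_HEPR hdiag))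
    (yBasisMatrix_conj_HEPR_nonneg hnonneg hdiag)
  have hspec : spectrum ℂ M = spectrum ℂ (HEPR n w) :=
    spectrum.units_conjugate (u := ⟨Bᴴ, B, hBB, hBB'⟩)
  refine ⟨c, hc0, hc, ?_⟩
  rw [← yBasisMatrix_mulVec fun z => (c z : ℂ), maxEigH, ← hspec, ← Matrix.mulVec_smul, ← hMc,
    Matrix.mulVec_mulVec, Matrix.mulVec_mulVec, ← Matrix.mul_assoc, ← Matrix.mul_assoc, hBB',
    Matrix.one_mul]
end
end

section
/- For every unweighted odd cycle C_{2k+1} with k ≥ 1, the maximum eigenvalue of the EPR Hamiltonian satisfies λ_max(H^EPR(C_{2k+1})) ≤ W(C_{2k+1}) + M(C_{2k+1}) = (2k+1) + k = 3k + 1. -/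
open Matrix Finset

noncomputable section

/-- Weight function of the unweighted cycle graph on `Fin (n+1)` (vertices `i` and
`i+1` mod `n+1` are adjacent). -/
def cycleW (n : ℕ) : Fin (n + 1) → Fin (n + 1) → ℝ :=
  fun i j => if i ≠ j ∧ (j = i + 1 ∨ i = j + 1) then 1 else 0

/-- Flip the qubits `i` and `j` of a computational basis state. -/
def flipPair {n : ℕ} (i j : Fin n) (x : QState n) : QState n :=
  fun l => if l = i ∨ l = j then x l + 1 else x l

theorem flipPair_comm {n : ℕ} (i j : Fin n) (x : QState n) :
    flipPair i j x = flipPair j i x := by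
  funext l
  simp only [flipPair, or_comm]

theorem fin_two_add_one_add_one (a : Fin 2) : a + 1 + 1 = a := by
  revert a; decide

theorem flipPair_flipPair {n : ℕ} (i j : Fin n) (x : QState n) :
    flipPair i j (flipPair i j x) = x := by
  funext l
  by_cases h : l = i ∨ l = j <;> simp [flipPair, h, fin_two_add_one_add_one]

theorem flipPair_agree {n : ℕ} (i j : Fin n) (x : QState n) :
    flipPair i j x i = flipPair i j x j ↔ x i = x j := by
  simp [flipPair]

theorem hEPR_apply {n : ℕ} {i j : Fin n} (hij : i ≠ j) (x y : QState n) :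
    hEPR n i j x y =
      if x i = x j then (if y = x then 1 else 0) + (if y = flipPair i j x then 1 else 0)
      else 0 := by
  have key : ∀ a b c d : Fin 2,
      (1 / 2 : ℂ) * ((if a = c ∧ b = d then 1 else 0) + pauliX a c * pauliX b d
          - pauliY a c * pauliY b d + pauliZ a c * pauliZ b d) =
        if a = b then (if c = a ∧ d = b then 1 else 0) +
          (if c = a + 1 ∧ d = b + 1 then 1 else 0) else 0 := by
    intro a b c d
    fin_cases a <;> fin_cases b <;> fin_cases c <;> fin_cases d <;>
      norm_num [pauliX, pauliY, pauliZ, show (1 : Fin 2) + 1 = 0 from rfl]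
  simp only [hEPR, twoSite, Matrix.smul_apply, Matrix.add_apply, Matrix.sub_apply,
    Matrix.of_apply, Matrix.one_apply, Finset.prod_ite_zero, Finset.prod_const_one, smul_eq_mul]
  by_cases hA : ∀ l ∈ (univ : Finset (Fin n)) \ {i, j}, x l = y l
  · have off : ∀ l, l ≠ i → l ≠ j → x l = y l := fun l hi hj => hA l (by simp [hi, hj])
    have e1 : x = y ↔ x i = y i ∧ x j = y j := by
      refine ⟨fun h => by simp [h], fun h => funext fun l => ?_⟩
      by_cases hi : l = i
      · exact hi ▸ h.1
      by_cases hj : l = j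
      · exact hj ▸ h.2
      exact off l hi hj
    have e2 : y = x ↔ y i = x i ∧ y j = x j := by
      rw [eq_comm, e1, eq_comm, @eq_comm _ (x j)]
    have e3 : y = flipPair i j x ↔ y i = x i + 1 ∧ y j = x j + 1 := by
      refine ⟨fun h => by simp [h, flipPair], fun h => funext fun l => ?_⟩
      by_cases hi : l = i
      · subst hi; simp [flipPair, h.1]
      by_cases hj : l = j
      · subst hj; simp [flipPair, h.2]
      simp [flipPair, hi, hj, off l hi hj]
    rw [if_pos hA]
    simp only [e1, e2, e3, mul_one]
    exact key (x i) (x j) (y i) (y j)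
  · have n1 : x ≠ y := fun h => hA (by simp [h])
    have n2 : y ≠ flipPair i j x := by
      rintro rfl
      refine hA fun l hl => ?_
      have hl' : ¬(l = i ∨ l = j) := by simpa using hl
      simp [flipPair, hl']
    rw [if_neg hA]
    simp [n1, n1.symm, n2]

theorem hEPR_mulVec {n : ℕ} {i j : Fin n} (hij : i ≠ j) (ψ : QState n → ℂ) (x : QState n) :
    (hEPR n i j *ᵥ ψ) x = if x i = x j then ψ x + ψ (flipPair i j x) else 0 := by
  simp only [Matrix.mulVec, dotProduct, hEPR_apply hij]
  split_ifs with h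
  · simp [add_mul, Finset.sum_add_distrib]
  · simp

theorem HEPR_mulVec {n : ℕ} (w : Fin n → Fin n → ℝ) (ψ : QState n → ℂ) (x : QState n) :
    (HEPR n w *ᵥ ψ) x = (1 / 2 : ℂ) * ∑ i, ∑ j, (w i j : ℂ) * (hEPR n i j *ᵥ ψ) x := by
  simp only [HEPR, Matrix.smul_mulVec, Matrix.sum_mulVec, Pi.smul_apply, Finset.sum_apply,
    smul_eq_mul]

open scoped Fin.CommRing in
theorem natCast_fin_ne_zero {m j : ℕ} (h0 : 0 < j) (hj : j ≤ m) : (j : Fin (m + 1)) ≠ 0 := by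
  intro h
  have := Nat.le_of_dvd h0 (Fin.natCast_eq_zero.mp h)
  omega

open scoped Fin.CommRing in
theorem HEPR_cycle_mulVec {m : ℕ} (hm : 2 ≤ m) (ψ : QState (m + 1) → ℂ) (x : QState (m + 1)) :
    (HEPR (m + 1) (cycleW m) *ᵥ ψ) x =
      ∑ i, if x i = x (i + 1) then ψ x + ψ (flipPair i (i + 1) x) else 0 := by
  have h1 : ∀ i : Fin (m + 1), i ≠ i + 1 := by
    intro i h
    refine natCast_fin_ne_zero (m := m) one_pos (by omega) ?_
    push_cast
    linear_combination -h
  have h2 : ∀ i : Fin (m + 1), i ≠ i + 1 + 1 := by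
    intro i h
    refine natCast_fin_ne_zero (m := m) two_pos (by omega) ?_
    push_cast
    linear_combination -h
  set G : Fin (m + 1) → Fin (m + 1) → ℂ :=
    fun i j => if x i = x j then ψ x + ψ (flipPair i j x) else 0 with hG
  have hsymm : ∀ i j, G i j = G j i := by
    intro i j
    simp only [hG, flipPair_comm i j, eq_comm]
  have hterm : ∀ i j, (cycleW m i j : ℂ) * (hEPR (m + 1) i j *ᵥ ψ) x =
      (if j = i + 1 then G i j else 0) + (if i = j + 1 then G i j else 0) := by
    intro i j
    by_cases hij : i = j
    · subst hij
      simp [cycleW, h1]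
    rw [hEPR_mulVec hij]
    by_cases ha : j = i + 1
    · have hb : i ≠ j + 1 := ha ▸ h2 i
      simp [cycleW, ha, hG, h1, h2]
    · by_cases hb : i = j + 1
      · simp [cycleW, hb, hG, h2, (h1 j).symm]
      · simp [cycleW, ha, hb]
  rw [HEPR_mulVec]
  simp only [hterm, Finset.sum_add_distrib]
  rw [Finset.sum_comm (f := fun i j => if i = j + 1 then G i j else 0)]
  simp only [Finset.sum_ite_eq', Finset.mem_univ, if_true]
  simp only [fun i => hsymm (i + 1) i]
  rw [← two_mul, ← mul_assoc, one_div, inv_mul_cancel₀ two_ne_zero, one_mul]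

/-- A weighted Schur test for the EPR Hamiltonian of a cycle. -/
theorem le_of_mem_spectrum_HEPR_cycle {m : ℕ} (hm : 2 ≤ m)
    (ρ : Fin (m + 1) → QState (m + 1) → ℝ) (hpos : ∀ e x, 0 < ρ e x)
    (hmul : ∀ e x, x e = x (e + 1) → 1 ≤ ρ e x * ρ e (flipPair e (e + 1) x)) {c : ℝ}
    (hc : ∀ x, (∑ e, if x e = x (e + 1) then 1 + ρ e x else 0) ≤ c) {r : ℝ}
    (hr : (r : ℂ) ∈ spectrum ℂ (HEPR (m + 1) (cycleW m))) : r ≤ c := by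
  obtain ⟨ψ, hψ, hψ0⟩ : ∃ ψ : QState (m + 1) → ℂ,
      HEPR (m + 1) (cycleW m) *ᵥ ψ = (r : ℂ) • ψ ∧ ψ ≠ 0 := by
    rw [← Matrix.spectrum_toLin', ← Module.End.hasEigenvalue_iff_mem_spectrum] at hr
    obtain ⟨ψ, hψ⟩ := hr.exists_hasEigenvector
    exact ⟨ψ, by simpa using hψ.apply_eq_smul, hψ.2⟩
  set a : QState (m + 1) → ℝ := fun x => ‖ψ x‖ with ha
  have hrow : ∀ x, r * a x ^ 2 ≤
      ∑ e, if x e = x (e + 1) then a x ^ 2 + a x * a (flipPair e (e + 1) x) else 0 := by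
    intro x
    have h := congrFun hψ x
    rw [HEPR_cycle_mulVec hm] at h
    have hle : r * a x ≤
        ∑ e, if x e = x (e + 1) then a x + a (flipPair e (e + 1) x) else 0 := by
      calc r * a x ≤ |r| * a x := by gcongr; exact le_abs_self r
        _ = ‖((r : ℂ) • ψ) x‖ := by simp [ha]
        _ ≤ _ := by
          rw [← h]
          refine (norm_sum_le _ _).trans (Finset.sum_le_sum fun e _ => ?_)
          split_ifs
          · exact norm_add_le _ _
          · simp
    calc r * a x ^ 2 = a x * (r * a x) := by ring
      _ ≤ _ := mul_le_mul_of_nonneg_left hle (norm_nonneg _)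
      _ = _ := by
        rw [Finset.mul_sum]
        refine Finset.sum_congr rfl fun e _ => ?_
        split_ifs <;> ring
  have hedge : ∀ e, (∑ x : QState (m + 1),
      if x e = x (e + 1) then a x ^ 2 + a x * a (flipPair e (e + 1) x) else 0) ≤
      ∑ x : QState (m + 1), if x e = x (e + 1) then (1 + ρ e x) * a x ^ 2 else 0 := by
    intro e
    set f : QState (m + 1) → ℝ := fun x => if x e = x (e + 1) then ρ e x * a x ^ 2 else 0 with hf
    have hinv : ∑ x, f (flipPair e (e + 1) x) = ∑ x, f x :=
      Equiv.sum_comp (Function.Involutive.toPerm _ (flipPair_flipPair e (e + 1))) f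
    calc _ ≤ ∑ x : QState (m + 1), ((if x e = x (e + 1) then a x ^ 2 else 0) +
          (f x + f (flipPair e (e + 1) x)) / 2) := by
          refine Finset.sum_le_sum fun x _ => ?_
          simp only [hf, flipPair_agree]
          split_ifs with h
          · have h1 := hpos e x
            have h2 := hmul e x h
            set s := ρ e x
            set t := ρ e (flipPair e (e + 1) x)
            set u := a x
            set v := a (flipPair e (e + 1) x)
            have h3 : 0 ≤ (s * u - v) ^ 2 + (s * t - 1) * v ^ 2 :=
              add_nonneg (sq_nonneg _) (mul_nonneg (by linarith) (sq_nonneg _))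
            have h4 : 0 ≤ s * (s * u ^ 2 + t * v ^ 2 - 2 * (u * v)) := by
              convert h3 using 1; ring
            have h5 := nonneg_of_mul_nonneg_right h4 h1
            linarith
          · simp
      _ = ∑ x : QState (m + 1), ((if x e = x (e + 1) then a x ^ 2 else 0) + f x) := by
          rw [Finset.sum_add_distrib, Finset.sum_add_distrib, ← Finset.sum_div,
            Finset.sum_add_distrib, hinv]
          ring
      _ = _ := by
          refine Finset.sum_congr rfl fun x _ => ?_
          simp only [hf]
          split_ifs <;> ring
  have hsum : r * ∑ x, a x ^ 2 ≤ c * ∑ x, a x ^ 2 := by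
    calc r * ∑ x, a x ^ 2 = ∑ x, r * a x ^ 2 := Finset.mul_sum _ _ _
      _ ≤ _ := Finset.sum_le_sum fun x _ => hrow x
      _ = _ := Finset.sum_comm
      _ ≤ _ := Finset.sum_le_sum fun e _ => hedge e
      _ = _ := Finset.sum_comm
      _ = ∑ x : QState (m + 1),
          (∑ e, if x e = x (e + 1) then 1 + ρ e x else 0) * a x ^ 2 := by
        refine Finset.sum_congr rfl fun x _ => ?_
        rw [Finset.sum_mul]
        refine Finset.sum_congr rfl fun e _ => ?_
        split_ifs <;> ring
      _ ≤ ∑ x, c * a x ^ 2 :=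
        Finset.sum_le_sum fun x _ => mul_le_mul_of_nonneg_right (hc x) (sq_nonneg _)
      _ = _ := (Finset.mul_sum _ _ _).symm
  obtain ⟨x, hx⟩ := Function.ne_iff.mp hψ0
  have hS : 0 < ∑ x, a x ^ 2 :=
    Finset.sum_pos' (fun _ _ => sq_nonneg _)
      ⟨x, Finset.mem_univ _, pow_pos (norm_pos_iff.mpr hx) 2⟩
  exact le_of_mul_le_mul_right hsum hS

/-- Whether the qubits `i` and `i + 1` agree. -/
def agree {m : ℕ} (x : QState (m + 1)) (i : Fin (m + 1)) : Bool := x i = x (i + 1)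

/-- The weight attached to an edge by the two edges beyond its neighbour, on one side. -/
def tailWeight (b c : Bool) : ℚ := if b then if c then 1 else 6 / 5 else 5 / 6

/-- The contribution of one side of an edge to its rate: `a` tells whether the neighbouring
edge agrees, and `t` is the weight of the tail beyond it. -/
def sideRate (a : Bool) (t : ℚ) : ℚ := if a then t else t⁻¹

/-- The rate of creating (or, inversely, annihilating) a pair of disagreeing edges. -/
def pairRate (κ : ℚ) (a b : Bool) : ℚ := if a then if b then κ else 1 else if b then 1 else κ⁻¹

/-- The rate attached to an edge whose three neighbouring edges on the left (from right to left)
are in the states `a₁ a₂ a₃` and on the right (from left to right) in the states `b₁ b₂ b₃`. -/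
def rate (κ : ℚ) (a₃ a₂ a₁ b₁ b₂ b₃ : Bool) : ℚ :=
  pairRate κ a₁ b₁ * sideRate a₁ (tailWeight a₂ a₃) * sideRate b₁ (tailWeight b₂ b₃)

theorem tailWeight_pos (b c : Bool) : 0 < tailWeight b c := by
  cases b <;> cases c <;> norm_num [tailWeight]

theorem rate_pos {κ : ℚ} (hκ : 0 < κ) (a₃ a₂ a₁ b₁ b₂ b₃ : Bool) :
    0 < rate κ a₃ a₂ a₁ b₁ b₂ b₃ := by
  have := tailWeight_pos a₂ a₃
  have := tailWeight_pos b₂ b₃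
  cases a₁ <;> cases b₁ <;> simp only [rate, pairRate, sideRate, if_true, if_false,
    Bool.false_eq_true] <;> positivity

theorem rate_mul_rate_not {κ : ℚ} (hκ : 0 < κ) (a₃ a₂ a₁ b₁ b₂ b₃ : Bool) :
    rate κ a₃ a₂ a₁ b₁ b₂ b₃ * rate κ a₃ a₂ (!a₁) (!b₁) b₂ b₃ = 1 := by
  have := tailWeight_pos a₂ a₃
  have := tailWeight_pos b₂ b₃
  cases a₁ <;> cases b₁ <;> simp only [rate, pairRate, sideRate, if_true, if_false,
    Bool.false_eq_true, Bool.not_true, Bool.not_false] <;> field_simp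

/-- The rate of the edge `e` in the state `x`. -/
def edgeRate {m : ℕ} (κ : ℚ) (e : Fin (m + 1)) (x : QState (m + 1)) : ℚ :=
  rate κ (agree x (e - 3)) (agree x (e - 2)) (agree x (e - 1))
    (agree x (e + 1)) (agree x (e + 2)) (agree x (e + 3))

theorem agree_flipPair_of_ne {m : ℕ} (x : QState (m + 1)) {e i : Fin (m + 1)}
    (h1 : i ≠ e + 1) (h2 : i + 1 ≠ e) :
    agree (flipPair e (e + 1) x) i = agree x i := by
  by_cases h : i = e
  · subst h
    simp [agree, flipPair]
  · have h' : i + 1 ≠ e + 1 := fun h3 => h (add_right_cancel h3)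
    simp [agree, flipPair, h, h1, h2, h']

theorem decide_add_one_eq (a b : Fin 2) : decide (a + 1 = b) = !decide (a = b) := by
  revert a b; decide

theorem decide_eq_add_one (a b : Fin 2) : decide (a = b + 1) = !decide (a = b) := by
  revert a b; decide

open scoped Fin.CommRing in
/-- The Schur test with the rates `edgeRate`, on cycles long enough for the window of an edge
not to overlap itself. -/
theorem le_of_sum_edgeRate_le {m : ℕ} (hm : 4 ≤ m) {κ : ℚ} (hκ : 0 < κ) {c : ℚ}
    (hc : ∀ x : QState (m + 1),
      (∑ e, if x e = x (e + 1) then 1 + edgeRate κ e x else 0) ≤ c) {r : ℝ}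
    (hr : (r : ℂ) ∈ spectrum ℂ (HEPR (m + 1) (cycleW m))) : r ≤ c := by
  have n1 : (1 : Fin (m + 1)) ≠ 0 := by
    simpa using natCast_fin_ne_zero (m := m) (j := 1) (by norm_num) (by omega)
  have n2 : (2 : Fin (m + 1)) ≠ 0 := by
    simpa using natCast_fin_ne_zero (m := m) (j := 2) (by norm_num) (by omega)
  have n3 : (3 : Fin (m + 1)) ≠ 0 := by
    simpa using natCast_fin_ne_zero (m := m) (j := 3) (by norm_num) (by omega)
  have n4 : (4 : Fin (m + 1)) ≠ 0 := by
    simpa using natCast_fin_ne_zero (m := m) (j := 4) (by norm_num) (by omega)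
  have far : ∀ (x : QState (m + 1)) (e i : Fin (m + 1)), i - e - 1 ≠ 0 → i - e + 1 ≠ 0 →
      agree (flipPair e (e + 1) x) i = agree x i := by
    intro x e i h1 h2
    refine agree_flipPair_of_ne x (fun h => h1 ?_) (fun h => h2 ?_)
    · rw [h]; ring
    · rw [← h]; ring
  have near₁ : ∀ (x : QState (m + 1)) (e : Fin (m + 1)),
      agree (flipPair e (e + 1) x) (e + 1) = !agree x (e + 1) := by
    intro x e
    have h1 : e + 1 + 1 ≠ e := fun h => n2 (by linear_combination h)
    have h2 : e + 1 + 1 ≠ e + 1 := fun h => n1 (by linear_combination h)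
    simp [agree, flipPair, h1, n1, decide_add_one_eq]
  have near₂ : ∀ (x : QState (m + 1)) (e : Fin (m + 1)),
      agree (flipPair e (e + 1) x) (e - 1) = !agree x (e - 1) := by
    intro x e
    have h1 : e - 1 ≠ e := fun h => n1 (by linear_combination -h)
    have h2 : e - 1 ≠ e + 1 := fun h => n2 (by linear_combination -h)
    simp only [agree, flipPair, h1, h2, sub_add_cancel, or_self, true_or, if_true, if_false,
      decide_eq_add_one]
  refine le_of_mem_spectrum_HEPR_cycle (by omega) (fun e x => (edgeRate κ e x : ℝ))
    (fun e x => by exact_mod_cast rate_pos hκ _ _ _ _ _ _) ?_ ?_ hr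
  · intro e x _
    have key : edgeRate κ e x * edgeRate κ e (flipPair e (e + 1) x) = 1 := by
      simp only [edgeRate, near₁, near₂]
      rw [far x e (e - 3) (fun h => n4 (by linear_combination -h))
          (fun h => n2 (by linear_combination -h)),
        far x e (e - 2) (fun h => n3 (by linear_combination -h))
          (fun h => n1 (by linear_combination -h)),
        far x e (e + 2) (fun h => n1 (by linear_combination h))
          (fun h => n3 (by linear_combination h)),
        far x e (e + 3) (fun h => n2 (by linear_combination h))
          (fun h => n4 (by linear_combination h))]
      exact rate_mul_rate_not hκ _ _ _ _ _ _
    exact_mod_cast key.ge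
  · intro x
    have h := hc x
    have h' : (((∑ e, if x e = x (e + 1) then 1 + edgeRate κ e x else 0 : ℚ)) : ℝ) ≤
        (c : ℝ) := by exact_mod_cast h
    simpa [apply_ite (Rat.cast : ℚ → ℝ)] using h'

/-- A potential on windows of six consecutive edges, in units of `1 / 18`. -/
def potentialTable : List ℕ :=
  [0, 0, 0, 0, 0, 0, 0, 0, 51, 51, 33, 41, 10, 10, 18, 14,
   25, 25, 25, 25, 7, 7, 15, 15, 30, 30, 25, 27, 23, 23, 22, 21,
   0, 0, 0, 0, 0, 0, 0, 0, 48, 48, 33, 40, 20, 20, 25, 22,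
   15, 15, 15, 15, 7, 7, 11, 11, 41, 41, 33, 37, 24, 24, 25, 23]

/-- The potential of a window of six consecutive edges. -/
def potential (a b c d e f : Bool) : ℚ :=
  (potentialTable.getD (32 * a.toNat + 16 * b.toNat + 8 * c.toNat + 4 * d.toNat + 2 * e.toNat
    + f.toNat) 0 : ℚ) / 18

theorem rate_add_potential_le : ∀ a₃ a₂ a₁ s b₁ b₂ b₃ : Bool,
    (if s then 1 + rate (4 / 9) a₃ a₂ a₁ b₁ b₂ b₃ else 0)
      + potential a₃ a₂ a₁ s b₁ b₂ ≤ 13 / 9 + potential a₂ a₁ s b₁ b₂ b₃ := by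
  decide +kernel

open scoped Fin.CommRing in
theorem sum_edgeRate_le {m : ℕ} (x : QState (m + 1)) :
    (∑ e, if x e = x (e + 1) then 1 + edgeRate (4 / 9) e x else 0) ≤
      13 / 9 * ((m : ℚ) + 1) := by
  set φ : Fin (m + 1) → ℚ := fun e => potential (agree x (e - 3)) (agree x (e - 2))
    (agree x (e - 1)) (agree x e) (agree x (e + 1)) (agree x (e + 2)) with hφ
  have hshift : ∑ e, φ (e + 1) = ∑ e, φ e := Equiv.sum_comp (Equiv.addRight 1) φ
  have hle : ∀ e, (if x e = x (e + 1) then 1 + edgeRate (4 / 9) e x else 0) + φ e ≤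
      13 / 9 + φ (e + 1) := by
    intro e
    have h := rate_add_potential_le (agree x (e - 3)) (agree x (e - 2)) (agree x (e - 1))
      (agree x e) (agree x (e + 1)) (agree x (e + 2)) (agree x (e + 3))
    have e1 : e + 1 - 3 = e - 2 := by ring
    have e2 : e + 1 - 2 = e - 1 := by ring
    have e3 : e + 1 - 1 = e := by ring
    have e4 : e + 1 + 1 = e + 2 := by ring
    have e5 : e + 1 + 2 = e + 3 := by ring
    have hs : agree x e = true ↔ x e = x (e + 1) := by simp [agree]
    simp only [hφ, e1, e2, e3, e4, e5, edgeRate]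
    simpa only [hs] using h
  have hsum := Finset.sum_le_sum fun e (_ : e ∈ univ) => hle e
  rw [Finset.sum_add_distrib, Finset.sum_add_distrib, hshift] at hsum
  have hconst : (∑ _e : Fin (m + 1), (13 / 9 : ℚ)) = 13 / 9 * ((m : ℚ) + 1) := by
    simp [mul_comm]
  rw [hconst] at hsum
  linarith

theorem sum_edgeRate_five_le : ∀ x : QState 5,
    (∑ e, if x e = x (e + 1) then 1 + edgeRate (2 / 5) e x else 0) ≤ 7 := by
  decide +kernel

theorem sum_edgeRate_seven_le : ∀ x : QState 7,
    (∑ e, if x e = x (e + 1) then 1 + edgeRate (3 / 7) e x else 0) ≤ 10 := by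
  decide +kernel

/-- Rates for the triangle. -/
def triangleRate (e : Fin 3) (x : QState 3) : ℚ := if x (e + 1) = x (e + 2) then 1 / 3 else 3

theorem one_le_triangleRate_mul : ∀ (e : Fin 3) (x : QState 3), x e = x (e + 1) →
    1 ≤ triangleRate e x * triangleRate e (flipPair e (e + 1) x) := by
  decide +kernel

theorem sum_triangleRate_le : ∀ x : QState 3,
    (∑ e, if x e = x (e + 1) then 1 + triangleRate e x else 0) ≤ 4 := by
  decide +kernel

theorem triangle_EPR_bound {r : ℝ} (hr : (r : ℂ) ∈ spectrum ℂ (HEPR 3 (cycleW 2))) : r ≤ 4 := by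
  refine le_of_mem_spectrum_HEPR_cycle le_rfl (fun e x => (triangleRate e x : ℝ)) ?_ ?_ ?_ hr
  · intro e x
    have : 0 < triangleRate e x := by
      unfold triangleRate
      split_ifs <;> norm_num
    exact_mod_cast this
  · intro e x h
    exact_mod_cast one_le_triangleRate_mul e x h
  · intro x
    have h : (((∑ e, if x e = x (e + 1) then 1 + triangleRate e x else 0 : ℚ)) : ℝ) ≤
        ((4 : ℚ) : ℝ) := by exact_mod_cast sum_triangleRate_le x
    simpa [apply_ite (Rat.cast : ℚ → ℝ)] using h

/-- For every odd cycle `C_{2k+1}` (`k ≥ 1`), every eigenvalue of the EPR Hamiltonian is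
at most `W + M = (2k+1) + k = 3k + 1`. -/
theorem oddCycle_EPR_bound (k : ℕ) (hk : 1 ≤ k) :
    ∀ r : ℝ, (r : ℂ) ∈ spectrum ℂ (HEPR (2 * k + 1) (cycleW (2 * k))) →
      r ≤ 3 * (k : ℝ) + 1 := by
  intro r hr
  obtain rfl | rfl | rfl | h4 : k = 1 ∨ k = 2 ∨ k = 3 ∨ 4 ≤ k := by omega
  · have := triangle_EPR_bound hr
    norm_num
    exact this
  · have := le_of_sum_edgeRate_le (m := 4) le_rfl (by norm_num) sum_edgeRate_five_le hr
    norm_num at this ⊢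
    exact this
  · have := le_of_sum_edgeRate_le (m := 6) (by norm_num) (by norm_num) sum_edgeRate_seven_le hr
    norm_num at this ⊢
    exact this
  · have h := le_of_sum_edgeRate_le (by omega) (by norm_num) sum_edgeRate_le hr
    push_cast at h
    have h4' : (4 : ℝ) ≤ k := by exact_mod_cast h4
    linarith
end
end
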